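/- Let τⁱ, τʲ be positive real numbers and t₁ⁱ, t₁ʲ real numbers, and set t₂ⁱ = t₁ⁱ + τⁱ and t₂ʲ = t₁ʲ + τʲ. If x ∈ [t₁ⁱ, t₂ʲ) and y ∈ [t₁ʲ, t₂ⁱ), then the intervals (x, x + τⁱ] and [y, y + τʲ) have nonempty intersection. (Consequently, the two CSA move constraints generated for an OUT–IN conflict — forbidding agent i's move into v starting in [t₁ⁱ, t₂ʲ) and agent j's move out of v starting in [t₁ʲ, t₂ⁱ) — are mutually disjunctive.) -/

import Mathlib

/-- MD of the CSA move constraints generated for an OUT–IN conflict: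
if agent i starts a move into v at `x ∈ [t₁ⁱ, t₂ʲ)` and agent j starts a move out of v at
`y ∈ [t₁ʲ, t₂ⁱ)`, then the occupancy intervals `(x, x + τⁱ]` and `[y, y + τʲ)` intersect. -/
theorem csa_out_in_mutually_disjunctive
    (τi τj t1i t1j : ℝ) (hτi : 0 < τi) (hτj : 0 < τj)
    (t2i t2j : ℝ) (ht2i : t2i = t1i + τi) (ht2j : t2j = t1j + τj)
    (x y : ℝ) (hx : x ∈ Set.Ico t1i t2j) (hy : y ∈ Set.Ico t1j t2i) :
    (Set.Ioc x (x + τi) ∩ Set.Ico y (y + τj)).Nonempty := by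
  obtain ⟨hx₁, hx₂⟩ := hx
  obtain ⟨hy₁, hy₂⟩ := hy
  rcases lt_or_ge x y with hxy | hyx
  · exact ⟨y, ⟨hxy, by linarith⟩, le_rfl, by linarith⟩
  · obtain ⟨z, hxz, hz⟩ :=
      exists_between (lt_min (show x < x + τi by linarith) (show x < y + τj by linarith))
    obtain ⟨hzi, hzj⟩ := lt_min_iff.mp hz
    exact ⟨z, ⟨hxz, hzi.le⟩, hyx.trans hxz.le, hzj⟩
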